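/- Soundness of the call-by-name linear-use CPS translation: if Θ ⊢ M =_{βη} N : τ, then Θⁿᶜ⊸R̲ ⊢ Mⁿᶜ = Nⁿᶜ : τⁿᶜ ⊸ R̲ in the equational theory of EEC. -/

import Mathlib

set_option autoImplicit false

namespace EEC

/-! # The enriched effect calculus (EEC)

A deep embedding of the enriched effect calculus of Egger, Møgelberg and
Simpson: value types and computation types, raw terms (de Bruijn indices for
value variables, together with a designated stoup variable `svar`), typing
derivations with an (at most singleton) stoup, the βη-equational theory, the
simply-typed λ-calculus together with βη-equality and Moggi's computational
λ-calculus equality, the standard cbv/cbn translations of typed λ-calculus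
into EEC, Hasegawa's linear-use CPS translations, and the generic linear-use
CPS self-translation of EEC. -/

mutual
  /-- Value types of EEC. -/
  inductive VType : Type
    | base : ℕ → VType                 -- value type constants α
    | unit : VType                     -- 1
    | prod : VType → VType → VType     -- A × B
    | arr : VType → VType → VType      -- A → B
    | comp : CType → VType             -- every computation type is a value type
    | lin : CType → CType → VType      -- A̲ ⊸ B̲
  /-- Computation types of EEC. -/
  inductive CType : Type
    | base : ℕ → CType                 -- computation type constants α̲
    | cunit : CType                    -- 1̲
    | cand : CType → CType → CType     -- A̲ & B̲
    | carr : VType → CType → CType     -- A ⇒ B̲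
    | iunit : CType                    -- I̲
    | bang : VType → CType             -- !A
    | copow : VType → CType → CType    -- !A ⊗ B̲
    | czero : CType                    -- 0̲
    | csum : CType → CType → CType     -- A̲ ⊕ B̲
end

/-- Raw terms of EEC.  Value variables are de Bruijn indices (`var n`, with
`var 0` the innermost bound variable); the unique stoup variable is `svar`
(the constructs `llam`, `copowlet` (in its body) and `ccase` (in its
branches) bind the stoup variable). -/
inductive Tm : Type
  | var : ℕ → Tm                -- value variable
  | svar : Tm                   -- the stoup variable
  | unit : Tm                   -- * : 1
  | vpair : Tm → Tm → Tm        -- ⟨t,u⟩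
  | vfst : Tm → Tm
  | vsnd : Tm → Tm
  | vlam : VType → Tm → Tm      -- λx:A. t
  | vapp : Tm → Tm → Tm
  | cunit : Tm                  -- ⋆ : 1̲
  | cpair : Tm → Tm → Tm        -- ⟨t,u⟩ : A̲ & B̲
  | cfst : Tm → Tm
  | csnd : Tm → Tm
  | clam : VType → Tm → Tm      -- λx:A ⇒ t
  | capp : Tm → Tm → Tm         -- s ⋅ t
  | top : Tm                    -- ⊤ : I̲
  | ilet : Tm → Tm → Tm         -- t to ⊤. u
  | bang : Tm → Tm              -- !t
  | banglet : Tm → Tm → Tm      -- let !x = t in u   (binds a value variable in u)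
  | copow : Tm → Tm → Tm        -- !t ⊗ u
  | copowlet : Tm → Tm → Tm     -- let !x⊗y = s in t (binds a value variable and the stoup variable in t)
  | cimage : CType → Tm → Tm    -- image_{A̲}(t)
  | cinl : Tm → Tm
  | cinr : Tm → Tm
  | ccase : Tm → Tm → Tm → Tm   -- case s of (x. t | y. u)  (branches bind the stoup variable)
  | llam : CType → Tm → Tm      -- λ°z:A̲. t (binds the stoup variable)
  | lapp : Tm → Tm → Tm         -- s[t]

namespace Tm

/-- Lift a renaming of value variables under a binder. -/
def liftN (f : ℕ → ℕ) : ℕ → ℕ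
  | 0 => 0
  | n + 1 => f n + 1

/-- Renaming of value variables. -/
def rename (f : ℕ → ℕ) : Tm → Tm
  | .var n => .var (f n)
  | .svar => .svar
  | .unit => .unit
  | .vpair t u => .vpair (rename f t) (rename f u)
  | .vfst t => .vfst (rename f t)
  | .vsnd t => .vsnd (rename f t)
  | .vlam A t => .vlam A (rename (liftN f) t)
  | .vapp s t => .vapp (rename f s) (rename f t)
  | .cunit => .cunit
  | .cpair t u => .cpair (rename f t) (rename f u)
  | .cfst t => .cfst (rename f t)
  | .csnd t => .csnd (rename f t)
  | .clam A t => .clam A (rename (liftN f) t)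
  | .capp s t => .capp (rename f s) (rename f t)
  | .top => .top
  | .ilet t u => .ilet (rename f t) (rename f u)
  | .bang t => .bang (rename f t)
  | .banglet t u => .banglet (rename f t) (rename (liftN f) u)
  | .copow t u => .copow (rename f t) (rename f u)
  | .copowlet s t => .copowlet (rename f s) (rename (liftN f) t)
  | .cimage A t => .cimage A (rename f t)
  | .cinl t => .cinl (rename f t)
  | .cinr t => .cinr (rename f t)
  | .ccase s t u => .ccase (rename f s) (rename f t) (rename f u)
  | .llam A t => .llam A (rename f t)
  | .lapp s t => .lapp (rename f s) (rename f t)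

/-- Weakening of value variables. -/
def shift (t : Tm) : Tm := rename Nat.succ t

/-- Lift a parallel substitution of value variables under a binder. -/
def liftS (σ : ℕ → Tm) : ℕ → Tm
  | 0 => .var 0
  | n + 1 => shift (σ n)

/-- Parallel (capture-avoiding) substitution for value variables. -/
def psubst (σ : ℕ → Tm) : Tm → Tm
  | .var n => σ n
  | .svar => .svar
  | .unit => .unit
  | .vpair t u => .vpair (psubst σ t) (psubst σ u)
  | .vfst t => .vfst (psubst σ t)
  | .vsnd t => .vsnd (psubst σ t)
  | .vlam A t => .vlam A (psubst (liftS σ) t)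
  | .vapp s t => .vapp (psubst σ s) (psubst σ t)
  | .cunit => .cunit
  | .cpair t u => .cpair (psubst σ t) (psubst σ u)
  | .cfst t => .cfst (psubst σ t)
  | .csnd t => .csnd (psubst σ t)
  | .clam A t => .clam A (psubst (liftS σ) t)
  | .capp s t => .capp (psubst σ s) (psubst σ t)
  | .top => .top
  | .ilet t u => .ilet (psubst σ t) (psubst σ u)
  | .bang t => .bang (psubst σ t)
  | .banglet t u => .banglet (psubst σ t) (psubst (liftS σ) u)
  | .copow t u => .copow (psubst σ t) (psubst σ u)
  | .copowlet s t => .copowlet (psubst σ s) (psubst (liftS σ) t)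
  | .cimage A t => .cimage A (psubst σ t)
  | .cinl t => .cinl (psubst σ t)
  | .cinr t => .cinr (psubst σ t)
  | .ccase s t u => .ccase (psubst σ s) (psubst σ t) (psubst σ u)
  | .llam A t => .llam A (psubst σ t)
  | .lapp s t => .lapp (psubst σ s) (psubst σ t)

/-- Capture-avoiding substitution `t[u/x]` of a term `u` for the innermost
value variable of `t`. -/
def subst0 (u : Tm) (t : Tm) : Tm :=
  psubst (fun n => match n with | 0 => u | m + 1 => .var m) t

/-- Capture-avoiding substitution `t[u/z]` of a term `u` for the stoup
variable of `t`.  The substitution stops at the stoup-variable binders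
(`llam`-bodies, `copowlet`-bodies and `ccase`-branches). -/
def ssubst (u : Tm) : Tm → Tm
  | .var n => .var n
  | .svar => u
  | .unit => .unit
  | .vpair t t' => .vpair (ssubst u t) (ssubst u t')
  | .vfst t => .vfst (ssubst u t)
  | .vsnd t => .vsnd (ssubst u t)
  | .vlam A t => .vlam A (ssubst (shift u) t)
  | .vapp s t => .vapp (ssubst u s) (ssubst u t)
  | .cunit => .cunit
  | .cpair t t' => .cpair (ssubst u t) (ssubst u t')
  | .cfst t => .cfst (ssubst u t)
  | .csnd t => .csnd (ssubst u t)
  | .clam A t => .clam A (ssubst (shift u) t)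
  | .capp s t => .capp (ssubst u s) (ssubst u t)
  | .top => .top
  | .ilet t t' => .ilet (ssubst u t) (ssubst u t')
  | .bang t => .bang (ssubst u t)
  | .banglet t t' => .banglet (ssubst u t) (ssubst (shift u) t')
  | .copow t t' => .copow (ssubst u t) (ssubst u t')
  | .copowlet s t => .copowlet (ssubst u s) t
  | .cimage A t => .cimage A (ssubst u t)
  | .cinl t => .cinl (ssubst u t)
  | .cinr t => .cinr (ssubst u t)
  | .ccase s t t' => .ccase (ssubst u s) t t'
  | .llam A t => .llam A t
  | .lapp s t => .lapp (ssubst u s) (ssubst u t)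

end Tm

/-- Typing derivations of EEC (Figure 1 of the paper).  `Deriv Γ none t A`
is the judgement `Γ ⊢ t : A` (empty stoup); `Deriv Γ (some A̲) t (.comp B̲)`
is the judgement `Γ | z:A̲ ⊢ t : B̲`.  In the rules below `Δ` ranges over an
arbitrary (possibly empty) stoup. -/
inductive Deriv : List VType → Option CType → Tm → VType → Type
  | var (Γ : List VType) (n : ℕ) (A : VType) :
      Γ[n]? = some A → Deriv Γ none (.var n) A
  | svar (Γ : List VType) (A : CType) : Deriv Γ (some A) .svar (.comp A)
  | unit (Γ : List VType) : Deriv Γ none .unit .unit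
  | vpair (Γ : List VType) (t u : Tm) (A B : VType) :
      Deriv Γ none t A → Deriv Γ none u B → Deriv Γ none (.vpair t u) (.prod A B)
  | vfst (Γ : List VType) (t : Tm) (A B : VType) :
      Deriv Γ none t (.prod A B) → Deriv Γ none (.vfst t) A
  | vsnd (Γ : List VType) (t : Tm) (A B : VType) :
      Deriv Γ none t (.prod A B) → Deriv Γ none (.vsnd t) B
  | vlam (Γ : List VType) (t : Tm) (A B : VType) :
      Deriv (A :: Γ) none t B → Deriv Γ none (.vlam A t) (.arr A B)
  | vapp (Γ : List VType) (s t : Tm) (A B : VType) :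
      Deriv Γ none s (.arr A B) → Deriv Γ none t A → Deriv Γ none (.vapp s t) B
  | cunit (Γ : List VType) (Δ : Option CType) : Deriv Γ Δ .cunit (.comp .cunit)
  | cpair (Γ : List VType) (Δ : Option CType) (t u : Tm) (A B : CType) :
      Deriv Γ Δ t (.comp A) → Deriv Γ Δ u (.comp B) →
      Deriv Γ Δ (.cpair t u) (.comp (.cand A B))
  | cfst (Γ : List VType) (Δ : Option CType) (t : Tm) (A B : CType) :
      Deriv Γ Δ t (.comp (.cand A B)) → Deriv Γ Δ (.cfst t) (.comp A)
  | csnd (Γ : List VType) (Δ : Option CType) (t : Tm) (A B : CType) :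
      Deriv Γ Δ t (.comp (.cand A B)) → Deriv Γ Δ (.csnd t) (.comp B)
  | clam (Γ : List VType) (Δ : Option CType) (t : Tm) (A : VType) (B : CType) :
      Deriv (A :: Γ) Δ t (.comp B) → Deriv Γ Δ (.clam A t) (.comp (.carr A B))
  | capp (Γ : List VType) (Δ : Option CType) (s t : Tm) (A : VType) (B : CType) :
      Deriv Γ Δ s (.comp (.carr A B)) → Deriv Γ none t A →
      Deriv Γ Δ (.capp s t) (.comp B)
  | top (Γ : List VType) : Deriv Γ none .top (.comp .iunit)
  | ilet (Γ : List VType) (Δ : Option CType) (t u : Tm) (A : CType) :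
      Deriv Γ Δ t (.comp .iunit) → Deriv Γ none u (.comp A) →
      Deriv Γ Δ (.ilet t u) (.comp A)
  | bang (Γ : List VType) (t : Tm) (A : VType) :
      Deriv Γ none t A → Deriv Γ none (.bang t) (.comp (.bang A))
  | banglet (Γ : List VType) (Δ : Option CType) (t u : Tm) (A : VType) (B : CType) :
      Deriv Γ Δ t (.comp (.bang A)) → Deriv (A :: Γ) none u (.comp B) →
      Deriv Γ Δ (.banglet t u) (.comp B)
  | copow (Γ : List VType) (Δ : Option CType) (t u : Tm) (A : VType) (B : CType) :
      Deriv Γ none t A → Deriv Γ Δ u (.comp B) →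
      Deriv Γ Δ (.copow t u) (.comp (.copow A B))
  | copowlet (Γ : List VType) (Δ : Option CType) (s t : Tm) (A : VType) (B C : CType) :
      Deriv Γ Δ s (.comp (.copow A B)) → Deriv (A :: Γ) (some B) t (.comp C) →
      Deriv Γ Δ (.copowlet s t) (.comp C)
  | cimage (Γ : List VType) (Δ : Option CType) (t : Tm) (A : CType) :
      Deriv Γ Δ t (.comp .czero) → Deriv Γ Δ (.cimage A t) (.comp A)
  | cinl (Γ : List VType) (Δ : Option CType) (t : Tm) (A B : CType) :
      Deriv Γ Δ t (.comp A) → Deriv Γ Δ (.cinl t) (.comp (.csum A B))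
  | cinr (Γ : List VType) (Δ : Option CType) (t : Tm) (A B : CType) :
      Deriv Γ Δ t (.comp B) → Deriv Γ Δ (.cinr t) (.comp (.csum A B))
  | ccase (Γ : List VType) (Δ : Option CType) (s t u : Tm) (A B C : CType) :
      Deriv Γ Δ s (.comp (.csum A B)) → Deriv Γ (some A) t (.comp C) →
      Deriv Γ (some B) u (.comp C) → Deriv Γ Δ (.ccase s t u) (.comp C)
  | llam (Γ : List VType) (t : Tm) (A B : CType) :
      Deriv Γ (some A) t (.comp B) → Deriv Γ none (.llam A t) (.lin A B)
  | lapp (Γ : List VType) (Δ : Option CType) (s t : Tm) (A B : CType) :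
      Deriv Γ none s (.lin A B) → Deriv Γ Δ t (.comp A) →
      Deriv Γ Δ (.lapp s t) (.comp B)

/-- The equational theory of EEC: the smallest type-respecting congruence
containing the βη-equalities of Figure 2 of the paper. -/
inductive EEq : List VType → Option CType → Tm → Tm → VType → Prop
  -- equivalence
  | refl {Γ Δ t A} : Deriv Γ Δ t A → EEq Γ Δ t t A
  | symm {Γ Δ t u A} : EEq Γ Δ t u A → EEq Γ Δ u t A
  | trans {Γ Δ t u v A} : EEq Γ Δ t u A → EEq Γ Δ u v A → EEq Γ Δ t v A
  -- congruence rules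
  | vpair_cong {Γ t t' u u' A B} : EEq Γ none t t' A → EEq Γ none u u' B →
      EEq Γ none (.vpair t u) (.vpair t' u') (.prod A B)
  | vfst_cong {Γ t t' A B} : EEq Γ none t t' (.prod A B) →
      EEq Γ none (.vfst t) (.vfst t') A
  | vsnd_cong {Γ t t' A B} : EEq Γ none t t' (.prod A B) →
      EEq Γ none (.vsnd t) (.vsnd t') B
  | vlam_cong {Γ t t' A B} : EEq (A :: Γ) none t t' B →
      EEq Γ none (.vlam A t) (.vlam A t') (.arr A B)
  | vapp_cong {Γ s s' t t' A B} : EEq Γ none s s' (.arr A B) → EEq Γ none t t' A →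
      EEq Γ none (.vapp s t) (.vapp s' t') B
  | cpair_cong {Γ Δ t t' u u' A B} : EEq Γ Δ t t' (.comp A) → EEq Γ Δ u u' (.comp B) →
      EEq Γ Δ (.cpair t u) (.cpair t' u') (.comp (.cand A B))
  | cfst_cong {Γ Δ t t' A B} : EEq Γ Δ t t' (.comp (.cand A B)) →
      EEq Γ Δ (.cfst t) (.cfst t') (.comp A)
  | csnd_cong {Γ Δ t t' A B} : EEq Γ Δ t t' (.comp (.cand A B)) →
      EEq Γ Δ (.csnd t) (.csnd t') (.comp B)
  | clam_cong {Γ Δ t t' A B} : EEq (A :: Γ) Δ t t' (.comp B) →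
      EEq Γ Δ (.clam A t) (.clam A t') (.comp (.carr A B))
  | capp_cong {Γ Δ s s' t t' A B} : EEq Γ Δ s s' (.comp (.carr A B)) → EEq Γ none t t' A →
      EEq Γ Δ (.capp s t) (.capp s' t') (.comp B)
  | ilet_cong {Γ Δ t t' u u' A} : EEq Γ Δ t t' (.comp .iunit) → EEq Γ none u u' (.comp A) →
      EEq Γ Δ (.ilet t u) (.ilet t' u') (.comp A)
  | bang_cong {Γ t t' A} : EEq Γ none t t' A →
      EEq Γ none (.bang t) (.bang t') (.comp (.bang A))
  | banglet_cong {Γ Δ t t' u u' A B} : EEq Γ Δ t t' (.comp (.bang A)) →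
      EEq (A :: Γ) none u u' (.comp B) →
      EEq Γ Δ (.banglet t u) (.banglet t' u') (.comp B)
  | copow_cong {Γ Δ t t' u u' A B} : EEq Γ none t t' A → EEq Γ Δ u u' (.comp B) →
      EEq Γ Δ (.copow t u) (.copow t' u') (.comp (.copow A B))
  | copowlet_cong {Γ Δ s s' t t' A B C} : EEq Γ Δ s s' (.comp (.copow A B)) →
      EEq (A :: Γ) (some B) t t' (.comp C) →
      EEq Γ Δ (.copowlet s t) (.copowlet s' t') (.comp C)
  | cimage_cong {Γ Δ t t' A} : EEq Γ Δ t t' (.comp .czero) →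
      EEq Γ Δ (.cimage A t) (.cimage A t') (.comp A)
  | cinl_cong {Γ Δ t t' A B} : EEq Γ Δ t t' (.comp A) →
      EEq Γ Δ (.cinl t) (.cinl t') (.comp (.csum A B))
  | cinr_cong {Γ Δ t t' A B} : EEq Γ Δ t t' (.comp B) →
      EEq Γ Δ (.cinr t) (.cinr t') (.comp (.csum A B))
  | ccase_cong {Γ Δ s s' t t' u u' A B C} : EEq Γ Δ s s' (.comp (.csum A B)) →
      EEq Γ (some A) t t' (.comp C) → EEq Γ (some B) u u' (.comp C) →
      EEq Γ Δ (.ccase s t u) (.ccase s' t' u') (.comp C)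
  | llam_cong {Γ t t' A B} : EEq Γ (some A) t t' (.comp B) →
      EEq Γ none (.llam A t) (.llam A t') (.lin A B)
  | lapp_cong {Γ Δ s s' t t' A B} : EEq Γ none s s' (.lin A B) → EEq Γ Δ t t' (.comp A) →
      EEq Γ Δ (.lapp s t) (.lapp s' t') (.comp B)
  -- the equalities of Figure 2
  | unit_eta {Γ t} : Deriv Γ none t .unit → EEq Γ none t .unit .unit
  | vfst_beta {Γ t u A B} : Deriv Γ none t A → Deriv Γ none u B →
      EEq Γ none (.vfst (.vpair t u)) t A
  | vsnd_beta {Γ t u A B} : Deriv Γ none t A → Deriv Γ none u B →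
      EEq Γ none (.vsnd (.vpair t u)) u B
  | vpair_eta {Γ t A B} : Deriv Γ none t (.prod A B) →
      EEq Γ none (.vpair (.vfst t) (.vsnd t)) t (.prod A B)
  | vlam_beta {Γ t u A B} : Deriv (A :: Γ) none t B → Deriv Γ none u A →
      EEq Γ none (.vapp (.vlam A t) u) (Tm.subst0 u t) B
  | vlam_eta {Γ t A B} : Deriv Γ none t (.arr A B) →
      EEq Γ none (.vlam A (.vapp (Tm.shift t) (.var 0))) t (.arr A B)
  | cunit_eta {Γ Δ t} : Deriv Γ Δ t (.comp .cunit) → EEq Γ Δ t .cunit (.comp .cunit)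
  | cfst_beta {Γ Δ t u A B} : Deriv Γ Δ t (.comp A) → Deriv Γ Δ u (.comp B) →
      EEq Γ Δ (.cfst (.cpair t u)) t (.comp A)
  | csnd_beta {Γ Δ t u A B} : Deriv Γ Δ t (.comp A) → Deriv Γ Δ u (.comp B) →
      EEq Γ Δ (.csnd (.cpair t u)) u (.comp B)
  | cpair_eta {Γ Δ t A B} : Deriv Γ Δ t (.comp (.cand A B)) →
      EEq Γ Δ (.cpair (.cfst t) (.csnd t)) t (.comp (.cand A B))
  | clam_beta {Γ Δ t u A B} : Deriv (A :: Γ) Δ t (.comp B) → Deriv Γ none u A →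
      EEq Γ Δ (.capp (.clam A t) u) (Tm.subst0 u t) (.comp B)
  | clam_eta {Γ Δ t A B} : Deriv Γ Δ t (.comp (.carr A B)) →
      EEq Γ Δ (.clam A (.capp (Tm.shift t) (.var 0))) t (.comp (.carr A B))
  | ilet_beta {Γ t A} : Deriv Γ none t (.comp A) →
      EEq Γ none (.ilet .top t) t (.comp A)
  | ilet_eta {Γ Δ t u A} : Deriv Γ Δ t (.comp .iunit) → Deriv Γ (some .iunit) u (.comp A) →
      EEq Γ Δ (.ilet t (Tm.ssubst .top u)) (Tm.ssubst t u) (.comp A)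
  | bang_beta {Γ t u A B} : Deriv Γ none t A → Deriv (A :: Γ) none u (.comp B) →
      EEq Γ none (.banglet (.bang t) u) (Tm.subst0 t u) (.comp B)
  | bang_eta {Γ Δ t u A B} : Deriv Γ Δ t (.comp (.bang A)) →
      Deriv Γ (some (.bang A)) u (.comp B) →
      EEq Γ Δ (.banglet t (Tm.ssubst (.bang (.var 0)) (Tm.shift u))) (Tm.ssubst t u) (.comp B)
  | copow_beta {Γ Δ t s u A B C} : Deriv Γ none t A → Deriv Γ Δ s (.comp B) →
      Deriv (A :: Γ) (some B) u (.comp C) →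
      EEq Γ Δ (.copowlet (.copow t s) u) (Tm.ssubst s (Tm.subst0 t u)) (.comp C)
  | copow_eta {Γ Δ t u A B C} : Deriv Γ Δ t (.comp (.copow A B)) →
      Deriv Γ (some (.copow A B)) u (.comp C) →
      EEq Γ Δ (.copowlet t (Tm.ssubst (.copow (.var 0) .svar) (Tm.shift u))) (Tm.ssubst t u) (.comp C)
  | czero_eta {Γ Δ t u A} : Deriv Γ Δ t (.comp .czero) → Deriv Γ (some .czero) u (.comp A) →
      EEq Γ Δ (.cimage A t) (Tm.ssubst t u) (.comp A)
  | csum_beta_inl {Γ Δ t u u' A B C} : Deriv Γ (some A) u (.comp C) →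
      Deriv Γ (some B) u' (.comp C) → Deriv Γ Δ t (.comp A) →
      EEq Γ Δ (.ccase (.cinl t) u u') (Tm.ssubst t u) (.comp C)
  | csum_beta_inr {Γ Δ t u u' A B C} : Deriv Γ (some A) u (.comp C) →
      Deriv Γ (some B) u' (.comp C) → Deriv Γ Δ t (.comp B) →
      EEq Γ Δ (.ccase (.cinr t) u u') (Tm.ssubst t u') (.comp C)
  | csum_eta {Γ Δ t u A B C} : Deriv Γ Δ t (.comp (.csum A B)) →
      Deriv Γ (some (.csum A B)) u (.comp C) →
      EEq Γ Δ (.ccase t (Tm.ssubst (.cinl .svar) u) (Tm.ssubst (.cinr .svar) u)) (Tm.ssubst t u) (.comp C)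
  | llam_beta {Γ Δ t u A B} : Deriv Γ (some A) t (.comp B) → Deriv Γ Δ u (.comp A) →
      EEq Γ Δ (.lapp (.llam A t) u) (Tm.ssubst u t) (.comp B)
  | llam_eta {Γ t A B} : Deriv Γ none t (.lin A B) →
      EEq Γ none (.llam A (.lapp t .svar)) t (.lin A B)

end EEC

namespace EEC

/-! ## The generic linear-use CPS self-translation of EEC (Figures 4–6) -/

mutual
  /-- CPS translation `Aᶜ` of value types, relative to the result type `R̲`. -/
  def cpsV (R : CType) : VType → VType
    | .base a => .base a
    | .unit => .unit
    | .prod A B => .prod (cpsV R A) (cpsV R B)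
    | .arr A B => .arr (cpsV R A) (cpsV R B)
    | .comp A => .lin (cpsC R A) R
    | .lin A B => .lin (cpsC R B) (cpsC R A)
  /-- CPS translation `A̲ᶜ` of computation types, relative to the result type
  `R̲` (a computation-type constant equal to `R̲` is translated to `I̲`). -/
  def cpsC (R : CType) : CType → CType
    | .base a =>
        match R with
        | .base b => if b = a then .iunit else .base a
        | _ => .base a
    | .cunit => .czero
    | .cand A B => .csum (cpsC R A) (cpsC R B)
    | .carr A B => .copow (cpsV R A) (cpsC R B)
    | .iunit => R
    | .bang A => .carr (cpsV R A) R
    | .copow A B => .carr (cpsV R A) (cpsC R B)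
    | .czero => .cunit
    | .csum A B => .cand (cpsC R A) (cpsC R B)
end

/-- Pointwise CPS translation `Γᶜ` of a context. -/
def cpsCtx (R : CType) (Γ : List VType) : List VType := Γ.map (cpsV R)

/-- The generic linear-use CPS self-translation on terms (Figures 5 and 6 of
the paper), defined by recursion on typing derivations.  A value judgement
`Γ ⊢ t : A` is sent to a term `tᶜ` with `Γᶜ ⊢ tᶜ : Aᶜ`, and a stoup
judgement `Γ | z:A̲ ⊢ t : B̲` is sent (contravariantly) to a term `tᶜ` with
`Γᶜ | k_z:B̲ᶜ ⊢ tᶜ : A̲ᶜ`. -/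
def cps (R : CType) : {Γ : List VType} → {Δ : Option CType} → {t : Tm} → {A : VType} →
    Deriv Γ Δ t A → Tm
  | _, _, _, _, .var _ n _ _ => .var n
  | _, _, _, _, .svar _ _ => .svar
  | _, _, _, _, .unit _ => .unit
  | _, _, _, _, .vpair _ _ _ _ _ d1 d2 => .vpair (cps R d1) (cps R d2)
  | _, _, _, _, .vfst _ _ _ _ d => .vfst (cps R d)
  | _, _, _, _, .vsnd _ _ _ _ d => .vsnd (cps R d)
  | _, _, _, _, .vlam _ _ A _ d => .vlam (cpsV R A) (cps R d)
  | _, _, _, _, .vapp _ _ _ _ _ d1 d2 => .vapp (cps R d1) (cps R d2)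
  | _, _, _, _, .cunit _ none => .llam .czero (.cimage R .svar)
  | _, _, _, _, .cunit _ (some D) => .cimage (cpsC R D) .svar
  | _, _, _, _, .cpair _ none _ _ A B d1 d2 =>
      .llam (.csum (cpsC R A) (cpsC R B))
        (.ccase .svar (.lapp (cps R d1) .svar) (.lapp (cps R d2) .svar))
  | _, _, _, _, .cpair _ (some _) _ _ _ _ d1 d2 => .ccase .svar (cps R d1) (cps R d2)
  | _, _, _, _, .cfst _ none _ A _ d => .llam (cpsC R A) (.lapp (cps R d) (.cinl .svar))
  | _, _, _, _, .cfst _ (some _) _ _ _ d => Tm.ssubst (.cinl .svar) (cps R d)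
  | _, _, _, _, .csnd _ none _ _ B d => .llam (cpsC R B) (.lapp (cps R d) (.cinr .svar))
  | _, _, _, _, .csnd _ (some _) _ _ _ d => Tm.ssubst (.cinr .svar) (cps R d)
  | _, _, _, _, .clam _ none _ A B d =>
      .llam (.copow (cpsV R A) (cpsC R B)) (.copowlet .svar (.lapp (cps R d) .svar))
  | _, _, _, _, .clam _ (some _) _ _ _ d => .copowlet .svar (cps R d)
  | _, _, _, _, .capp _ none _ _ _ B d1 d2 =>
      .llam (cpsC R B) (.lapp (cps R d1) (.copow (cps R d2) .svar))
  | _, _, _, _, .capp _ (some _) _ _ _ _ d1 d2 =>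
      Tm.ssubst (.copow (cps R d2) .svar) (cps R d1)
  | _, _, _, _, .top _ => .llam R .svar
  | _, _, _, _, .ilet _ none _ _ A d1 d2 =>
      .llam (cpsC R A) (.lapp (cps R d1) (.lapp (cps R d2) .svar))
  | _, _, _, _, .ilet _ (some _) _ _ _ d1 d2 =>
      Tm.ssubst (.lapp (cps R d2) .svar) (cps R d1)
  | _, _, _, _, .bang _ _ A d => .llam (.carr (cpsV R A) R) (.capp .svar (cps R d))
  | _, _, _, _, .banglet _ none _ _ A B d1 d2 =>
      .llam (cpsC R B) (.lapp (cps R d1) (.clam (cpsV R A) (.lapp (cps R d2) .svar)))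
  | _, _, _, _, .banglet _ (some _) _ _ A _ d1 d2 =>
      Tm.ssubst (.clam (cpsV R A) (.lapp (cps R d2) .svar)) (cps R d1)
  | _, _, _, _, .copow _ none _ _ A B d1 d2 =>
      .llam (.carr (cpsV R A) (cpsC R B)) (.lapp (cps R d2) (.capp .svar (cps R d1)))
  | _, _, _, _, .copow _ (some _) _ _ _ _ d1 d2 =>
      Tm.ssubst (.capp .svar (cps R d1)) (cps R d2)
  | _, _, _, _, .copowlet _ none _ _ A _ C d1 d2 =>
      .llam (cpsC R C) (.lapp (cps R d1) (.clam (cpsV R A) (cps R d2)))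
  | _, _, _, _, .copowlet _ (some _) _ _ A _ _ d1 d2 =>
      Tm.ssubst (.clam (cpsV R A) (cps R d2)) (cps R d1)
  | _, _, _, _, .cimage _ none _ A d => .llam (cpsC R A) (.lapp (cps R d) .cunit)
  | _, _, _, _, .cimage _ (some _) _ _ d => Tm.ssubst .cunit (cps R d)
  | _, _, _, _, .cinl _ none _ A B d =>
      .llam (.cand (cpsC R A) (cpsC R B)) (.lapp (cps R d) (.cfst .svar))
  | _, _, _, _, .cinl _ (some _) _ _ _ d => Tm.ssubst (.cfst .svar) (cps R d)
  | _, _, _, _, .cinr _ none _ A B d =>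
      .llam (.cand (cpsC R A) (cpsC R B)) (.lapp (cps R d) (.csnd .svar))
  | _, _, _, _, .cinr _ (some _) _ _ _ d => Tm.ssubst (.csnd .svar) (cps R d)
  | _, _, _, _, .ccase _ none _ _ _ _ _ C d1 d2 d3 =>
      .llam (cpsC R C) (.lapp (cps R d1) (.cpair (cps R d2) (cps R d3)))
  | _, _, _, _, .ccase _ (some _) _ _ _ _ _ _ d1 d2 d3 =>
      Tm.ssubst (.cpair (cps R d2) (cps R d3)) (cps R d1)
  | _, _, _, _, .llam _ _ _ B d => .llam (cpsC R B) (cps R d)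
  | _, _, _, _, .lapp _ none _ _ _ B d1 d2 =>
      .llam (cpsC R B) (.lapp (cps R d2) (.lapp (cps R d1) .svar))
  | _, _, _, _, .lapp _ (some _) _ _ _ _ d1 d2 =>
      Tm.ssubst (.lapp (cps R d1) .svar) (cps R d2)

end EEC

namespace EEC

/-! ## The type isomorphisms `ι` of Figure 7, with explicit inverses -/

mutual
  /-- The closed term `ι_A : (Aᶜ)ᶜ → A` (Figure 7). -/
  def iotaV (R : CType) : VType → Tm
    | .base a => .vlam (.base a) (.var 0)
    | .unit => .vlam .unit .unit
    | .prod A B => .vlam (cpsV R (cpsV R (.prod A B)))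
        (.vpair (.vapp (iotaV R A) (.vfst (.var 0))) (.vapp (iotaV R B) (.vsnd (.var 0))))
    | .arr A B => .vlam (cpsV R (cpsV R (.arr A B)))
        (.vlam A (.vapp (iotaV R B) (.vapp (.var 1) (.vapp (iotaVinv R A) (.var 0)))))
    | .comp A => .vlam (cpsV R (cpsV R (.comp A)))
        (.lapp (iotaC R A) (.lapp (.var 0) .top))
    | .lin A B => .vlam (cpsV R (cpsV R (.lin A B)))
        (.llam A (.lapp (iotaC R B) (.lapp (.var 0) (.lapp (iotaCinv R A) .svar))))
  /-- The closed term `ι_A⁻¹ : A → (Aᶜ)ᶜ`. -/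
  def iotaVinv (R : CType) : VType → Tm
    | .base a => .vlam (.base a) (.var 0)
    | .unit => .vlam .unit .unit
    | .prod A B => .vlam (.prod A B)
        (.vpair (.vapp (iotaVinv R A) (.vfst (.var 0))) (.vapp (iotaVinv R B) (.vsnd (.var 0))))
    | .arr A B => .vlam (.arr A B)
        (.vlam (cpsV R (cpsV R A)) (.vapp (iotaVinv R B) (.vapp (.var 1) (.vapp (iotaV R A) (.var 0)))))
    | .comp A => .vlam (.comp A)
        (.llam .iunit (.ilet .svar (.lapp (iotaCinv R A) (.var 0))))
    | .lin A B => .vlam (.lin A B)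
        (.llam (cpsC R (cpsC R A)) (.lapp (iotaCinv R B) (.lapp (.var 0) (.lapp (iotaC R A) .svar))))
  /-- The closed term `ι_A̲ : (A̲ᶜ)ᶜ ⊸ A̲` (Figure 7). -/
  def iotaC (R : CType) : CType → Tm
    | .base a => .llam (cpsC R (cpsC R (.base a))) .svar
    | .cunit => .llam (cpsC R (cpsC R .cunit)) .cunit
    | .cand A B => .llam (cpsC R (cpsC R (.cand A B)))
        (.cpair (.lapp (iotaC R A) (.cfst .svar)) (.lapp (iotaC R B) (.csnd .svar)))
    | .carr A B => .llam (cpsC R (cpsC R (.carr A B)))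
        (.clam A (.lapp (iotaC R B) (.capp .svar (.vapp (iotaVinv R A) (.var 0)))))
    | .iunit => .llam (cpsC R (cpsC R .iunit)) .svar
    | .bang A => .llam (cpsC R (cpsC R (.bang A)))
        (.copowlet .svar (.ilet .svar (.bang (.vapp (iotaV R A) (.var 0)))))
    | .copow A B => .llam (cpsC R (cpsC R (.copow A B)))
        (.copowlet .svar (.copow (.vapp (iotaV R A) (.var 0)) (.lapp (iotaC R B) .svar)))
    | .czero => .llam (cpsC R (cpsC R .czero)) .svar
    | .csum A B => .llam (cpsC R (cpsC R (.csum A B)))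
        (.ccase .svar (.cinl (.lapp (iotaC R A) .svar)) (.cinr (.lapp (iotaC R B) .svar)))
  /-- The closed term `ι_A̲⁻¹ : A̲ ⊸ (A̲ᶜ)ᶜ`. -/
  def iotaCinv (R : CType) : CType → Tm
    | .base a => .llam (.base a) .svar
    | .cunit => .llam .cunit .cunit
    | .cand A B => .llam (.cand A B)
        (.cpair (.lapp (iotaCinv R A) (.cfst .svar)) (.lapp (iotaCinv R B) (.csnd .svar)))
    | .carr A B => .llam (.carr A B)
        (.clam (cpsV R (cpsV R A)) (.lapp (iotaCinv R B) (.capp .svar (.vapp (iotaV R A) (.var 0)))))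
    | .iunit => .llam .iunit .svar
    | .bang A => .llam (.bang A)
        (.banglet .svar (.copow (.vapp (iotaVinv R A) (.var 0)) .top))
    | .copow A B => .llam (.copow A B)
        (.copowlet .svar (.copow (.vapp (iotaVinv R A) (.var 0)) (.lapp (iotaCinv R B) .svar)))
    | .czero => .llam .czero .svar
    | .csum A B => .llam (.csum A B)
        (.ccase .svar (.cinl (.lapp (iotaCinv R A) .svar)) (.cinr (.lapp (iotaCinv R B) .svar)))
end

/-- The substitution `[ι⁻¹(Γ)]`, replacing each variable `xᵢ : Cᵢ` of `Γ` by
`ι_{Cᵢ}⁻¹(xᵢ)`. -/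
def iotaSubst (R : CType) (Γ : List VType) (t : Tm) : Tm :=
  Tm.psubst (fun n =>
    match Γ[n]? with
    | some C => .vapp (iotaVinv R C) (.var n)
    | none => .var n) t

/-! ## The simply-typed λ-calculus -/

/-- Simple types. -/
inductive STy : Type
  | base : ℕ → STy
  | unit : STy
  | prod : STy → STy → STy
  | arr : STy → STy → STy

/-- Raw simply-typed λ-terms (de Bruijn indices). -/
inductive LTm : Type
  | var : ℕ → LTm
  | unit : LTm
  | pair : LTm → LTm → LTm
  | fst : LTm → LTm
  | snd : LTm → LTm
  | lam : STy → LTm → LTm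
  | app : LTm → LTm → LTm

namespace LTm

/-- Renaming of variables. -/
def rename (f : ℕ → ℕ) : LTm → LTm
  | .var n => .var (f n)
  | .unit => .unit
  | .pair M N => .pair (rename f M) (rename f N)
  | .fst M => .fst (rename f M)
  | .snd M => .snd (rename f M)
  | .lam σ M => .lam σ (rename (Tm.liftN f) M)
  | .app M N => .app (rename f M) (rename f N)

/-- Weakening. -/
def shift (M : LTm) : LTm := rename Nat.succ M

/-- Parallel capture-avoiding substitution. -/
def psubst (σ : ℕ → LTm) : LTm → LTm
  | .var n => σ n
  | .unit => .unit
  | .pair M N => .pair (psubst σ M) (psubst σ N)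
  | .fst M => .fst (psubst σ M)
  | .snd M => .snd (psubst σ M)
  | .lam τ M => .lam τ (psubst (fun n => match n with | 0 => .var 0 | m + 1 => shift (σ m)) M)
  | .app M N => .app (psubst σ M) (psubst σ N)

/-- Capture-avoiding substitution `M[N/x]` for the innermost variable. -/
def subst0 (N : LTm) (M : LTm) : LTm :=
  psubst (fun n => match n with | 0 => N | m + 1 => .var m) M

end LTm

/-- Typing derivations of the simply-typed λ-calculus (Figure 3). -/
inductive LDeriv : List STy → LTm → STy → Type
  | var (Θ : List STy) (n : ℕ) (σ : STy) : Θ[n]? = some σ → LDeriv Θ (.var n) σ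
  | unit (Θ : List STy) : LDeriv Θ .unit .unit
  | pair (Θ : List STy) (M N : LTm) (σ τ : STy) :
      LDeriv Θ M σ → LDeriv Θ N τ → LDeriv Θ (.pair M N) (.prod σ τ)
  | fst (Θ : List STy) (M : LTm) (σ τ : STy) :
      LDeriv Θ M (.prod σ τ) → LDeriv Θ (.fst M) σ
  | snd (Θ : List STy) (M : LTm) (σ τ : STy) :
      LDeriv Θ M (.prod σ τ) → LDeriv Θ (.snd M) τ
  | lam (Θ : List STy) (M : LTm) (σ τ : STy) :
      LDeriv (σ :: Θ) M τ → LDeriv Θ (.lam σ M) (.arr σ τ)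
  | app (Θ : List STy) (M N : LTm) (σ τ : STy) :
      LDeriv Θ M (.arr σ τ) → LDeriv Θ N σ → LDeriv Θ (.app M N) τ

/-- Values of the (call-by-value) λ-calculus. -/
inductive LVal : LTm → Prop
  | var (n : ℕ) : LVal (.var n)
  | unit : LVal .unit
  | lam (σ : STy) (M : LTm) : LVal (.lam σ M)
  | pair {M N : LTm} : LVal M → LVal N → LVal (.pair M N)

/-- βη-equality of the simply-typed λ-calculus. -/
inductive LBetaEta : List STy → LTm → LTm → STy → Prop
  | refl {Θ M σ} : LDeriv Θ M σ → LBetaEta Θ M M σ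
  | symm {Θ M N σ} : LBetaEta Θ M N σ → LBetaEta Θ N M σ
  | trans {Θ M N P σ} : LBetaEta Θ M N σ → LBetaEta Θ N P σ → LBetaEta Θ M P σ
  | pair_cong {Θ M M' N N' σ τ} : LBetaEta Θ M M' σ → LBetaEta Θ N N' τ →
      LBetaEta Θ (.pair M N) (.pair M' N') (.prod σ τ)
  | fst_cong {Θ M M' σ τ} : LBetaEta Θ M M' (.prod σ τ) → LBetaEta Θ (.fst M) (.fst M') σ
  | snd_cong {Θ M M' σ τ} : LBetaEta Θ M M' (.prod σ τ) → LBetaEta Θ (.snd M) (.snd M') τ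
  | lam_cong {Θ M M' σ τ} : LBetaEta (σ :: Θ) M M' τ →
      LBetaEta Θ (.lam σ M) (.lam σ M') (.arr σ τ)
  | app_cong {Θ M M' N N' σ τ} : LBetaEta Θ M M' (.arr σ τ) → LBetaEta Θ N N' σ →
      LBetaEta Θ (.app M N) (.app M' N') τ
  | beta {Θ M N σ τ} : LDeriv (σ :: Θ) M τ → LDeriv Θ N σ →
      LBetaEta Θ (.app (.lam σ M) N) (LTm.subst0 N M) τ
  | eta {Θ M σ τ} : LDeriv Θ M (.arr σ τ) →
      LBetaEta Θ (.lam σ (.app (LTm.shift M) (.var 0))) M (.arr σ τ)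
  | fst_beta {Θ M N σ τ} : LDeriv Θ M σ → LDeriv Θ N τ →
      LBetaEta Θ (.fst (.pair M N)) M σ
  | snd_beta {Θ M N σ τ} : LDeriv Θ M σ → LDeriv Θ N τ →
      LBetaEta Θ (.snd (.pair M N)) N τ
  | pair_eta {Θ M σ τ} : LDeriv Θ M (.prod σ τ) →
      LBetaEta Θ (.pair (.fst M) (.snd M)) M (.prod σ τ)
  | unit_eta {Θ M} : LDeriv Θ M .unit → LBetaEta Θ M .unit .unit

/-- Equality in Moggi's computational λ-calculus `λc` (call-by-value
βη-equalities restricted to values, together with the `let`-laws, expressed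
via the standard encoding `let x = M in N := (λx.N) M`). -/
inductive LamC : List STy → LTm → LTm → STy → Prop
  | refl {Θ M σ} : LDeriv Θ M σ → LamC Θ M M σ
  | symm {Θ M N σ} : LamC Θ M N σ → LamC Θ N M σ
  | trans {Θ M N P σ} : LamC Θ M N σ → LamC Θ N P σ → LamC Θ M P σ
  | pair_cong {Θ M M' N N' σ τ} : LamC Θ M M' σ → LamC Θ N N' τ →
      LamC Θ (.pair M N) (.pair M' N') (.prod σ τ)
  | fst_cong {Θ M M' σ τ} : LamC Θ M M' (.prod σ τ) → LamC Θ (.fst M) (.fst M') σ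
  | snd_cong {Θ M M' σ τ} : LamC Θ M M' (.prod σ τ) → LamC Θ (.snd M) (.snd M') τ
  | lam_cong {Θ M M' σ τ} : LamC (σ :: Θ) M M' τ →
      LamC Θ (.lam σ M) (.lam σ M') (.arr σ τ)
  | app_cong {Θ M M' N N' σ τ} : LamC Θ M M' (.arr σ τ) → LamC Θ N N' σ →
      LamC Θ (.app M N) (.app M' N') τ
  | beta_v {Θ M V σ τ} : LDeriv (σ :: Θ) M τ → LDeriv Θ V σ → LVal V →
      LamC Θ (.app (.lam σ M) V) (LTm.subst0 V M) τ
  | eta_v {Θ V σ τ} : LVal V → LDeriv Θ V (.arr σ τ) →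
      LamC Θ (.lam σ (.app (LTm.shift V) (.var 0))) V (.arr σ τ)
  | fst_beta_v {Θ V W σ τ} : LVal V → LVal W → LDeriv Θ V σ → LDeriv Θ W τ →
      LamC Θ (.fst (.pair V W)) V σ
  | snd_beta_v {Θ V W σ τ} : LVal V → LVal W → LDeriv Θ V σ → LDeriv Θ W τ →
      LamC Θ (.snd (.pair V W)) W τ
  | pair_eta_v {Θ V σ τ} : LVal V → LDeriv Θ V (.prod σ τ) →
      LamC Θ (.pair (.fst V) (.snd V)) V (.prod σ τ)
  | unit_eta_v {Θ V} : LVal V → LDeriv Θ V .unit → LamC Θ V .unit .unit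
  | let_eta {Θ M σ} : LDeriv Θ M σ → LamC Θ (.app (.lam σ (.var 0)) M) M σ
  | let_assoc {Θ M N L σ ρ τ} : LDeriv (σ :: Θ) M τ → LDeriv (ρ :: Θ) N σ →
      LDeriv Θ L ρ →
      LamC Θ (.app (.lam σ M) (.app (.lam ρ N) L))
        (.app (.lam ρ (.app (.lam σ (LTm.rename (Tm.liftN Nat.succ) M)) N)) L) τ
  | app_left {Θ M N σ τ} : LDeriv Θ M (.arr σ τ) → LDeriv Θ N σ →
      LamC Θ (.app M N) (.app (.lam (.arr σ τ) (.app (.var 0) (LTm.shift N))) M) τ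
  | app_right {Θ V N σ τ} : LVal V → LDeriv Θ V (.arr σ τ) → LDeriv Θ N σ →
      LamC Θ (.app V N) (.app (.lam σ (.app (LTm.shift V) (.var 0))) N) τ
  | pair_left {Θ M N σ τ} : LDeriv Θ M σ → LDeriv Θ N τ →
      LamC Θ (.pair M N) (.app (.lam σ (.pair (.var 0) (LTm.shift N))) M) (.prod σ τ)
  | pair_right {Θ V N σ τ} : LVal V → LDeriv Θ V σ → LDeriv Θ N τ →
      LamC Θ (.pair V N) (.app (.lam τ (.pair (LTm.shift V) (.var 0))) N) (.prod σ τ)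
  | fst_cc {Θ M σ τ} : LDeriv Θ M (.prod σ τ) →
      LamC Θ (.fst M) (.app (.lam (.prod σ τ) (.fst (.var 0))) M) σ
  | snd_cc {Θ M σ τ} : LDeriv Θ M (.prod σ τ) →
      LamC Θ (.snd M) (.app (.lam (.prod σ τ) (.snd (.var 0))) M) τ

end EEC

namespace EEC

/-! ## The standard cbv and cbn translations of typed λ-calculus into EEC -/

/-- The computation-type constant `α̲` associated with a simply-typed
λ-calculus type constant `α` (the association is injective but not
surjective, so that some computation-type constants of EEC are different
from `α̲` for every λ-calculus type constant `α`). -/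
def assocC (a : ℕ) : CType := .base (a + 1)

/-- The call-by-value translation `σᵛ` on types. -/
def cbvT : STy → VType
  | .base a => .base a
  | .unit => .unit
  | .prod σ τ => .prod (cbvT σ) (cbvT τ)
  | .arr σ τ => .arr (cbvT σ) (.comp (.bang (cbvT τ)))

/-- The call-by-value translation `Θᵛ` on contexts. -/
def cbvCtx (Θ : List STy) : List VType := Θ.map cbvT

/-- The call-by-value translation on terms: `Θ ⊢ M : τ` is sent to
`Θᵛ ⊢ Mᵛ : !(τᵛ)`. -/
def cbvTm : LTm → Tm
  | .var n => .bang (.var n)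
  | .unit => .bang .unit
  | .pair M N => .banglet (cbvTm M) (.banglet (Tm.shift (cbvTm N)) (.bang (.vpair (.var 1) (.var 0))))
  | .fst M => .banglet (cbvTm M) (.bang (.vfst (.var 0)))
  | .snd M => .banglet (cbvTm M) (.bang (.vsnd (.var 0)))
  | .lam σ M => .bang (.vlam (cbvT σ) (cbvTm M))
  | .app M N => .banglet (cbvTm M) (.banglet (Tm.shift (cbvTm N)) (.vapp (.var 1) (.var 0)))

/-- The call-by-name translation `σⁿ` on types. -/
def cbnT : STy → CType
  | .base a => assocC a
  | .unit => .cunit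
  | .prod σ τ => .cand (cbnT σ) (cbnT τ)
  | .arr σ τ => .carr (.comp (cbnT σ)) (cbnT τ)

/-- The call-by-name translation `Θⁿ` on contexts. -/
def cbnCtx (Θ : List STy) : List VType := Θ.map (fun σ => .comp (cbnT σ))

/-- The call-by-name translation on terms: `Θ ⊢ M : τ` is sent to
`Θⁿ ⊢ Mⁿ : τⁿ`, mimicking each construct by the corresponding
computation-type construct of EEC. -/
def cbnTm : LTm → Tm
  | .var n => .var n
  | .unit => .cunit
  | .pair M N => .cpair (cbnTm M) (cbnTm N)
  | .fst M => .cfst (cbnTm M)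
  | .snd M => .csnd (cbnTm M)
  | .lam σ M => .clam (.comp (cbnT σ)) (cbnTm M)
  | .app M N => .capp (cbnTm M) (cbnTm N)

/-! ## Hasegawa's linear-use CPS translations (Section 4) -/

/-- The call-by-value linear-use CPS translation `σᵛᶜ` on types. -/
def cbvcpsT (R : CType) : STy → VType
  | .base a => .base a
  | .unit => .unit
  | .prod σ τ => .prod (cbvcpsT R σ) (cbvcpsT R τ)
  | .arr σ τ => .arr (cbvcpsT R σ) (.lin (.carr (cbvcpsT R τ) R) R)

/-- `Θᵛᶜ`. -/
def cbvcpsCtx (R : CType) (Θ : List STy) : List VType := Θ.map (cbvcpsT R)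

/-- The call-by-value linear-use CPS translation on terms: `Θ ⊢ M : τ` is
sent to `Θᵛᶜ ⊢ Mᵛᶜ : (τᵛᶜ ⇒ R̲) ⊸ R̲`. -/
def cbvcps (R : CType) : {Θ : List STy} → {M : LTm} → {σ : STy} → LDeriv Θ M σ → Tm
  | _, _, _, .var _ n σ _ => .llam (.carr (cbvcpsT R σ) R) (.capp .svar (.var n))
  | _, _, _, .unit _ => .llam (.carr .unit R) (.capp .svar .unit)
  | _, _, _, .pair _ _ _ σ τ dM dN =>
      .llam (.carr (.prod (cbvcpsT R σ) (cbvcpsT R τ)) R)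
        (.lapp (cbvcps R dM)
          (.clam (cbvcpsT R σ)
            (.lapp (Tm.shift (cbvcps R dN))
              (.clam (cbvcpsT R τ) (.capp .svar (.vpair (.var 1) (.var 0)))))))
  | _, _, _, .fst _ _ σ τ dM =>
      .llam (.carr (cbvcpsT R σ) R)
        (.lapp (cbvcps R dM)
          (.clam (.prod (cbvcpsT R σ) (cbvcpsT R τ)) (.capp .svar (.vfst (.var 0)))))
  | _, _, _, .snd _ _ σ τ dM =>
      .llam (.carr (cbvcpsT R τ) R)
        (.lapp (cbvcps R dM)
          (.clam (.prod (cbvcpsT R σ) (cbvcpsT R τ)) (.capp .svar (.vsnd (.var 0)))))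
  | _, _, _, .lam _ _ σ τ dM =>
      .llam (.carr (.arr (cbvcpsT R σ) (.lin (.carr (cbvcpsT R τ) R) R)) R)
        (.capp .svar (.vlam (cbvcpsT R σ) (cbvcps R dM)))
  | _, _, _, .app _ _ _ σ τ dM dN =>
      .llam (.carr (cbvcpsT R τ) R)
        (.lapp (cbvcps R dM)
          (.clam (.arr (cbvcpsT R σ) (.lin (.carr (cbvcpsT R τ) R) R))
            (.lapp (Tm.shift (cbvcps R dN))
              (.clam (cbvcpsT R σ) (.lapp (.vapp (.var 1) (.var 0)) .svar)))))

/-- The call-by-name linear-use CPS translation `σⁿᶜ` on types. -/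
def cbncpsT (R : CType) : STy → CType
  | .base a => assocC a
  | .unit => .czero
  | .prod σ τ => .csum (cbncpsT R σ) (cbncpsT R τ)
  | .arr σ τ => .copow (.lin (cbncpsT R σ) R) (cbncpsT R τ)

/-- `Θⁿᶜ ⊸ R̲`, assigning each variable `xᵢ : σᵢ` the type `σᵢⁿᶜ ⊸ R̲`. -/
def cbncpsCtx (R : CType) (Θ : List STy) : List VType :=
  Θ.map (fun σ => .lin (cbncpsT R σ) R)

/-- The call-by-name linear-use CPS translation on terms: `Θ ⊢ M : τ` is
sent to `Θⁿᶜ ⊸ R̲ ⊢ Mⁿᶜ : τⁿᶜ ⊸ R̲`. -/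
def cbncps (R : CType) : {Θ : List STy} → {M : LTm} → {σ : STy} → LDeriv Θ M σ → Tm
  | _, _, _, .var _ n _ _ => .var n
  | _, _, _, .unit _ => .llam .czero (.cimage R .svar)
  | _, _, _, .pair _ _ _ σ τ dM dN =>
      .llam (.csum (cbncpsT R σ) (cbncpsT R τ))
        (.ccase .svar (.lapp (cbncps R dM) .svar) (.lapp (cbncps R dN) .svar))
  | _, _, _, .fst _ _ σ _τ dM => .llam (cbncpsT R σ) (.lapp (cbncps R dM) (.cinl .svar))
  | _, _, _, .snd _ _ _ τ dM => .llam (cbncpsT R τ) (.lapp (cbncps R dM) (.cinr .svar))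
  | _, _, _, .lam _ _ σ τ dM =>
      .llam (.copow (.lin (cbncpsT R σ) R) (cbncpsT R τ))
        (.copowlet .svar (.lapp (cbncps R dM) .svar))
  | _, _, _, .app _ _ _ σ τ dM dN =>
      .llam (cbncpsT R τ) (.lapp (cbncps R dM) (.copow (cbncps R dN) .svar))

end EEC

namespace EEC

theorem LDeriv.type_unique {Θ : List STy} {M : LTm} {σ τ : STy}
    (d : LDeriv Θ M σ) (e : LDeriv Θ M τ) : σ = τ := by
  induction d generalizing τ with
  | var Θ n σ h =>
    cases e with
    | var _ _ _ h' => exact Option.some.inj (h.symm.trans h')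
  | unit Θ => cases e; rfl
  | pair Θ M N σ τ _ _ ihM ihN =>
    cases e with
    | pair _ _ _ _ _ eM eN => rw [ihM eM, ihN eN]
  | fst Θ M σ τ _ ih =>
    cases e with
    | fst _ _ _ _ e => exact (STy.prod.inj (ih e)).1
  | snd Θ M σ τ _ ih =>
    cases e with
    | snd _ _ _ _ e => exact (STy.prod.inj (ih e)).2
  | lam Θ M σ τ _ ih =>
    cases e with
    | lam _ _ _ _ e => rw [ih e]
  | app Θ M N σ τ _ _ ihM _ =>
    cases e with
    | app _ _ _ _ _ eM _ => exact (STy.arr.inj (ihM eM)).2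

instance LDeriv.instSubsingleton (Θ : List STy) (M : LTm) (σ : STy) :
    Subsingleton (LDeriv Θ M σ) where
  allEq d e := by
    induction d with
    | var Θ n σ h => cases e; rfl
    | unit Θ => cases e; rfl
    | pair Θ M N σ τ _ _ ihM ihN =>
      cases e with
      | pair _ _ _ _ _ eM eN => rw [ihM eM, ihN eN]
    | fst Θ M σ τ d ih =>
      cases e with
      | fst _ _ _ τ' e =>
        obtain rfl : τ = τ' := (STy.prod.inj (d.type_unique e)).2
        rw [ih e]
    | snd Θ M σ τ d ih =>
      cases e with
      | snd _ _ σ' _ e =>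
        obtain rfl : σ = σ' := (STy.prod.inj (d.type_unique e)).1
        rw [ih e]
    | lam Θ M σ τ _ ih =>
      cases e with
      | lam _ _ _ _ e => rw [ih e]
    | app Θ M N σ τ _ dN ihM ihN =>
      cases e with
      | app _ _ _ σ' _ eM eN =>
        obtain rfl : σ = σ' := dN.type_unique eN
        rw [ihM eM, ihN eN]

theorem cbncps_rename (R : CType) {Θ : List STy} {M : LTm} {τ : STy} (d : LDeriv Θ M τ)
    {Θ' : List STy} {f : ℕ → ℕ} (hf : ∀ n σ, Θ[n]? = some σ → Θ'[f n]? = some σ) :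
    ∃ d' : LDeriv Θ' (LTm.rename f M) τ, cbncps R d' = Tm.rename f (cbncps R d) := by
  induction d generalizing Θ' f with
  | var Θ n σ h => exact ⟨.var _ _ _ (hf n σ h), rfl⟩
  | unit Θ => exact ⟨.unit _, rfl⟩
  | pair Θ M N σ τ _ _ ihM ihN =>
    obtain ⟨eM, hM⟩ := ihM hf
    obtain ⟨eN, hN⟩ := ihN hf
    exact ⟨.pair _ _ _ _ _ eM eN, by simp [cbncps, Tm.rename, hM, hN]⟩
  | fst Θ M σ τ _ ih =>
    obtain ⟨e, h⟩ := ih hf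
    exact ⟨.fst _ _ _ _ e, by simp [cbncps, Tm.rename, h]⟩
  | snd Θ M σ τ _ ih =>
    obtain ⟨e, h⟩ := ih hf
    exact ⟨.snd _ _ _ _ e, by simp [cbncps, Tm.rename, h]⟩
  | lam Θ M σ τ _ ih =>
    have hf' : ∀ n ρ, (σ :: Θ)[n]? = some ρ → (σ :: Θ')[Tm.liftN f n]? = some ρ := by
      rintro (_ | n) ρ h
      · exact h
      · exact hf n ρ h
    obtain ⟨e, h⟩ := ih hf'
    exact ⟨.lam _ _ _ _ e, by simp [cbncps, Tm.rename, h]⟩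
  | app Θ M N σ τ _ _ ihM ihN =>
    obtain ⟨eM, hM⟩ := ihM hf
    obtain ⟨eN, hN⟩ := ihN hf
    exact ⟨.app _ _ _ _ _ eM eN, by simp [cbncps, Tm.rename, hM, hN]⟩

theorem cbncps_shift (R : CType) {Θ : List STy} {M : LTm} {τ : STy} (d : LDeriv Θ M τ)
    (σ : STy) :
    ∃ d' : LDeriv (σ :: Θ) (LTm.shift M) τ, cbncps R d' = Tm.shift (cbncps R d) :=
  cbncps_rename R d fun _ _ h => h

theorem cbncps_psubst (R : CType) {Θ : List STy} {M : LTm} {τ : STy} (d : LDeriv Θ M τ)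
    {Θ' : List STy} {s : ℕ → LTm} {s' : ℕ → Tm}
    (hs : ∀ n σ, Θ[n]? = some σ → ∃ e : LDeriv Θ' (s n) σ, cbncps R e = s' n) :
    ∃ d' : LDeriv Θ' (LTm.psubst s M) τ, cbncps R d' = Tm.psubst s' (cbncps R d) := by
  induction d generalizing Θ' s s' with
  | var Θ n σ h => exact hs n σ h
  | unit Θ => exact ⟨.unit _, rfl⟩
  | pair Θ M N σ τ _ _ ihM ihN =>
    obtain ⟨eM, hM⟩ := ihM hs
    obtain ⟨eN, hN⟩ := ihN hs
    exact ⟨.pair _ _ _ _ _ eM eN, by simp [cbncps, Tm.psubst, hM, hN]⟩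
  | fst Θ M σ τ _ ih =>
    obtain ⟨e, h⟩ := ih hs
    exact ⟨.fst _ _ _ _ e, by simp [cbncps, Tm.psubst, h]⟩
  | snd Θ M σ τ _ ih =>
    obtain ⟨e, h⟩ := ih hs
    exact ⟨.snd _ _ _ _ e, by simp [cbncps, Tm.psubst, h]⟩
  | lam Θ M σ τ _ ih =>
    obtain ⟨e, h⟩ := ih (Θ' := σ :: Θ') (s' := Tm.liftS s')
      (s := fun n => match n with | 0 => .var 0 | m + 1 => LTm.shift (s m)) (by
        rintro (_ | n) ρ h
        · exact ⟨.var _ _ _ h, rfl⟩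
        · obtain ⟨e, he⟩ := hs n ρ h
          obtain ⟨e', he'⟩ := cbncps_shift R e σ
          exact ⟨e', he'.trans (congrArg Tm.shift he)⟩)
    exact ⟨.lam _ _ _ _ e, by simp [cbncps, Tm.psubst, h]⟩
  | app Θ M N σ τ _ _ ihM ihN =>
    obtain ⟨eM, hM⟩ := ihM hs
    obtain ⟨eN, hN⟩ := ihN hs
    exact ⟨.app _ _ _ _ _ eM eN, by simp [cbncps, Tm.psubst, hM, hN]⟩

theorem cbncps_subst0 (R : CType) {Θ : List STy} {M N : LTm} {σ τ : STy}
    (dM : LDeriv (σ :: Θ) M τ) (dN : LDeriv Θ N σ) :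
    ∃ d : LDeriv Θ (LTm.subst0 N M) τ,
      cbncps R d = Tm.subst0 (cbncps R dN) (cbncps R dM) := by
  refine cbncps_psubst R dM ?_
  rintro (_ | n) ρ h
  · obtain rfl : σ = ρ := Option.some.inj h
    exact ⟨dN, rfl⟩
  · exact ⟨.var _ _ _ h, rfl⟩

/-- The translation of a term has no free stoup variable. -/
theorem ssubst_cbncps (R : CType) {Θ : List STy} {M : LTm} {τ : STy} (d : LDeriv Θ M τ)
    (u : Tm) : Tm.ssubst u (cbncps R d) = cbncps R d := by
  cases d <;> rfl

/-- The translation of a term is well typed. -/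
def cbncpsDeriv (R : CType) : {Θ : List STy} → {M : LTm} → {τ : STy} → (d : LDeriv Θ M τ) →
    Deriv (cbncpsCtx R Θ) none (cbncps R d) (.lin (cbncpsT R τ) R)
  | _, _, _, .var _ _ _ h => .var _ _ _ (by simp [cbncpsCtx, h])
  | _, _, _, .unit _ => .llam _ _ _ _ (.cimage _ _ _ _ (.svar _ _))
  | _, _, _, .pair _ _ _ _ _ dM dN =>
      .llam _ _ _ _ (.ccase _ _ _ _ _ _ _ _ (.svar _ _)
        (.lapp _ _ _ _ _ _ (cbncpsDeriv R dM) (.svar _ _))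
        (.lapp _ _ _ _ _ _ (cbncpsDeriv R dN) (.svar _ _)))
  | _, _, _, .fst _ _ _ _ d =>
      .llam _ _ _ _ (.lapp _ _ _ _ _ _ (cbncpsDeriv R d) (.cinl _ _ _ _ _ (.svar _ _)))
  | _, _, _, .snd _ _ _ _ d =>
      .llam _ _ _ _ (.lapp _ _ _ _ _ _ (cbncpsDeriv R d) (.cinr _ _ _ _ _ (.svar _ _)))
  | _, _, _, .lam _ _ _ _ d =>
      .llam _ _ _ _ (.copowlet _ _ _ _ _ _ _ (.svar _ _)
        (.lapp _ _ _ _ _ _ (cbncpsDeriv R d) (.svar _ _)))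
  | _, _, _, .app _ _ _ _ _ dM dN =>
      .llam _ _ _ _ (.lapp _ _ _ _ _ _ (cbncpsDeriv R dM)
        (.copow _ _ _ _ _ _ (cbncpsDeriv R dN) (.svar _ _)))

/-- The application of a translated term to the stoup variable. -/
def cbncpsLappDeriv (R : CType) {Θ : List STy} {M : LTm} {τ : STy} (d : LDeriv Θ M τ) :
    Deriv (cbncpsCtx R Θ) (some (cbncpsT R τ)) (.lapp (cbncps R d) .svar) (.comp R) :=
  .lapp _ _ _ _ _ _ (cbncpsDeriv R d) (.svar _ _)

theorem ssubst_lapp_cbncps (R : CType) {Θ : List STy} {M : LTm} {τ : STy} (d : LDeriv Θ M τ)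
    (u : Tm) : Tm.ssubst u (.lapp (cbncps R d) .svar) = .lapp (cbncps R d) u := by
  simp [Tm.ssubst, ssubst_cbncps]

/-- Extensionality: it suffices to compare bodies applied to the stoup variable. -/
theorem llam_eq_cbncps (R : CType) {Θ : List STy} {M : LTm} {τ : STy} (d : LDeriv Θ M τ)
    {t : Tm} (h : EEq (cbncpsCtx R Θ) (some (cbncpsT R τ)) t (.lapp (cbncps R d) .svar)
      (.comp R)) :
    EEq (cbncpsCtx R Θ) none (.llam (cbncpsT R τ) t) (cbncps R d) (.lin (cbncpsT R τ) R) :=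
  (EEq.llam_cong h).trans (.llam_eta (cbncpsDeriv R d))

/-- The β-rule for `⊸`, with the substituted body given up to syntactic equality. -/
theorem llam_beta_of_eq {Γ : List VType} {Δ : Option CType} {t u v : Tm} {A B : CType}
    (dt : Deriv Γ (some A) t (.comp B)) (du : Deriv Γ Δ u (.comp A))
    (h : Tm.ssubst u t = v) : EEq Γ Δ (.lapp (.llam A t) u) v (.comp B) :=
  h ▸ .llam_beta dt du

theorem cbncps_beta (R : CType) {Θ : List STy} {M N : LTm} {σ τ : STy}
    (dM : LDeriv (σ :: Θ) M τ) (dN : LDeriv Θ N σ) (d : LDeriv Θ (LTm.subst0 N M) τ) :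
    EEq (cbncpsCtx R Θ) none (cbncps R (.app _ _ _ _ _ (.lam _ _ _ _ dM) dN)) (cbncps R d)
      (.lin (cbncpsT R τ) R) := by
  have hd : cbncps R d = Tm.subst0 (cbncps R dN) (cbncps R dM) := by
    obtain ⟨e, he⟩ := cbncps_subst0 R dM dN
    rw [← he, Subsingleton.elim d e]
  refine llam_eq_cbncps R d (.trans (llam_beta_of_eq
    (.copowlet _ _ _ _ _ _ _ (.svar _ _) (cbncpsLappDeriv R dM))
    (.copow _ _ _ _ _ _ (cbncpsDeriv R dN) (.svar _ _)) rfl) ?_)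
  have h := EEq.copow_beta (cbncpsDeriv R dN) (.svar _ (cbncpsT R τ)) (cbncpsLappDeriv R dM)
  have e : Tm.ssubst .svar (Tm.subst0 (cbncps R dN) (.lapp (cbncps R dM) .svar))
      = .lapp (cbncps R d) .svar := by
    rw [← ssubst_lapp_cbncps R d, hd]; rfl
  exact e ▸ h

theorem cbncps_eta (R : CType) {Θ : List STy} {M : LTm} {σ τ : STy}
    (d : LDeriv Θ M (.arr σ τ)) (d' : LDeriv (σ :: Θ) (LTm.shift M) (.arr σ τ)) :
    EEq (cbncpsCtx R Θ) none
      (cbncps R (.lam _ _ _ _ (.app _ _ _ _ _ d' (.var _ 0 σ rfl)))) (cbncps R d)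
      (.lin (cbncpsT R (.arr σ τ)) R) := by
  have hd : cbncps R d' = Tm.shift (cbncps R d) := by
    obtain ⟨e, he⟩ := cbncps_shift R d σ
    rw [← he, Subsingleton.elim d' e]
  refine llam_eq_cbncps R d (.trans (.copowlet_cong (.refl (.svar _ _)) (llam_beta_of_eq
    (v := .lapp (cbncps R d') (.copow (.var 0) .svar))
    (.lapp _ _ _ _ _ _ (cbncpsDeriv R d') (.copow _ _ _ _ _ _
      (cbncpsDeriv R (.var (σ :: Θ) 0 σ rfl)) (.svar _ _))) (.svar _ _) ?_)) ?_)
  · simp [Tm.ssubst, ssubst_cbncps, cbncps]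
  · have h := EEq.copow_eta (.svar (cbncpsCtx R Θ) _) (cbncpsLappDeriv R d)
    rw [ssubst_lapp_cbncps] at h
    have e : Tm.ssubst (.copow (.var 0) .svar) (Tm.shift (.lapp (cbncps R d) .svar))
        = .lapp (cbncps R d') (.copow (.var 0) .svar) := by
      rw [← ssubst_lapp_cbncps R d', hd]; rfl
    exact e ▸ h

theorem cbncps_fst_beta (R : CType) {Θ : List STy} {M N : LTm} {σ τ : STy}
    (dM : LDeriv Θ M σ) (dN : LDeriv Θ N τ) :
    EEq (cbncpsCtx R Θ) none (cbncps R (.fst _ _ _ _ (.pair _ _ _ _ _ dM dN))) (cbncps R dM)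
      (.lin (cbncpsT R σ) R) := by
  refine llam_eq_cbncps R dM (.trans (llam_beta_of_eq
    (.ccase _ _ _ _ _ _ _ _ (.svar _ _) (cbncpsLappDeriv R dM) (cbncpsLappDeriv R dN))
    (.cinl _ _ _ _ _ (.svar _ _)) rfl) ?_)
  have h := EEq.csum_beta_inl (cbncpsLappDeriv R dM) (cbncpsLappDeriv R dN) (.svar _ _)
  rwa [ssubst_lapp_cbncps] at h

theorem cbncps_snd_beta (R : CType) {Θ : List STy} {M N : LTm} {σ τ : STy}
    (dM : LDeriv Θ M σ) (dN : LDeriv Θ N τ) :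
    EEq (cbncpsCtx R Θ) none (cbncps R (.snd _ _ _ _ (.pair _ _ _ _ _ dM dN))) (cbncps R dN)
      (.lin (cbncpsT R τ) R) := by
  refine llam_eq_cbncps R dN (.trans (llam_beta_of_eq
    (.ccase _ _ _ _ _ _ _ _ (.svar _ _) (cbncpsLappDeriv R dM) (cbncpsLappDeriv R dN))
    (.cinr _ _ _ _ _ (.svar _ _)) rfl) ?_)
  have h := EEq.csum_beta_inr (cbncpsLappDeriv R dM) (cbncpsLappDeriv R dN) (.svar _ _)
  rwa [ssubst_lapp_cbncps] at h

theorem cbncps_pair_eta (R : CType) {Θ : List STy} {M : LTm} {σ τ : STy}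
    (d : LDeriv Θ M (.prod σ τ)) :
    EEq (cbncpsCtx R Θ) none (cbncps R (.pair _ _ _ _ _ (.fst _ _ _ _ d) (.snd _ _ _ _ d)))
      (cbncps R d) (.lin (cbncpsT R (.prod σ τ)) R) := by
  refine llam_eq_cbncps R d (.trans (.ccase_cong (.refl (.svar _ _))
    (llam_beta_of_eq (v := .lapp (cbncps R d) (.cinl .svar))
      (.lapp _ _ _ _ _ _ (cbncpsDeriv R d) (.cinl _ _ _ _ _ (.svar _ _))) (.svar _ _) ?_)
    (llam_beta_of_eq (v := .lapp (cbncps R d) (.cinr .svar))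
      (.lapp _ _ _ _ _ _ (cbncpsDeriv R d) (.cinr _ _ _ _ _ (.svar _ _))) (.svar _ _) ?_)) ?_)
  · simp [Tm.ssubst, ssubst_cbncps]
  · simp [Tm.ssubst, ssubst_cbncps]
  · have h := EEq.csum_eta (.svar (cbncpsCtx R Θ) _) (cbncpsLappDeriv R d)
    rw [ssubst_lapp_cbncps, ssubst_lapp_cbncps, ssubst_lapp_cbncps] at h
    exact h

theorem cbncps_unit_eta (R : CType) {Θ : List STy} {M : LTm} (d : LDeriv Θ M .unit) :
    EEq (cbncpsCtx R Θ) none (cbncps R (.unit Θ)) (cbncps R d) (.lin .czero R) := by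
  refine llam_eq_cbncps R d ?_
  have h := EEq.czero_eta (.svar (cbncpsCtx R Θ) _) (cbncpsLappDeriv R d)
  rwa [ssubst_lapp_cbncps] at h

theorem LBetaEta.exists_cbncps_eq (R : CType) {Θ : List STy} {M N : LTm} {τ : STy}
    (h : LBetaEta Θ M N τ) :
    ∃ (dM : LDeriv Θ M τ) (dN : LDeriv Θ N τ),
      EEq (cbncpsCtx R Θ) none (cbncps R dM) (cbncps R dN) (.lin (cbncpsT R τ) R) := by
  induction h with
  | refl d => exact ⟨d, d, .refl (cbncpsDeriv R d)⟩
  | symm _ ih =>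
    obtain ⟨d, e, h⟩ := ih
    exact ⟨e, d, h.symm⟩
  | trans _ _ ih₁ ih₂ =>
    obtain ⟨d₁, e₁, h₁⟩ := ih₁
    obtain ⟨d₂, e₂, h₂⟩ := ih₂
    obtain rfl := Subsingleton.elim e₁ d₂
    exact ⟨d₁, e₂, h₁.trans h₂⟩
  | pair_cong _ _ ih₁ ih₂ =>
    obtain ⟨d₁, e₁, h₁⟩ := ih₁
    obtain ⟨d₂, e₂, h₂⟩ := ih₂
    exact ⟨.pair _ _ _ _ _ d₁ d₂, .pair _ _ _ _ _ e₁ e₂, .llam_cong (.ccase_cong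
      (.refl (.svar _ _)) (.lapp_cong h₁ (.refl (.svar _ _))) (.lapp_cong h₂ (.refl (.svar _ _))))⟩
  | fst_cong _ ih =>
    obtain ⟨d, e, h⟩ := ih
    exact ⟨.fst _ _ _ _ d, .fst _ _ _ _ e,
      .llam_cong (.lapp_cong h (.refl (.cinl _ _ _ _ _ (.svar _ _))))⟩
  | snd_cong _ ih =>
    obtain ⟨d, e, h⟩ := ih
    exact ⟨.snd _ _ _ _ d, .snd _ _ _ _ e,
      .llam_cong (.lapp_cong h (.refl (.cinr _ _ _ _ _ (.svar _ _))))⟩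
  | lam_cong _ ih =>
    obtain ⟨d, e, h⟩ := ih
    exact ⟨.lam _ _ _ _ d, .lam _ _ _ _ e, .llam_cong (.copowlet_cong
      (.refl (.svar _ _)) (.lapp_cong h (.refl (.svar _ _))))⟩
  | app_cong _ _ ih₁ ih₂ =>
    obtain ⟨d₁, e₁, h₁⟩ := ih₁
    obtain ⟨d₂, e₂, h₂⟩ := ih₂
    exact ⟨.app _ _ _ _ _ d₁ d₂, .app _ _ _ _ _ e₁ e₂,
      .llam_cong (.lapp_cong h₁ (.copow_cong h₂ (.refl (.svar _ _))))⟩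
  | beta dM dN =>
    obtain ⟨d, _⟩ := cbncps_subst0 R dM dN
    exact ⟨_, d, cbncps_beta R dM dN d⟩
  | eta d =>
    obtain ⟨d', _⟩ := cbncps_shift R d _
    exact ⟨_, d, cbncps_eta R d d'⟩
  | fst_beta dM dN => exact ⟨_, dM, cbncps_fst_beta R dM dN⟩
  | snd_beta dM dN => exact ⟨_, dN, cbncps_snd_beta R dM dN⟩
  | pair_eta d => exact ⟨_, d, cbncps_pair_eta R d⟩
  | unit_eta d => exact ⟨d, _, (cbncps_unit_eta R d).symm⟩

/-- **Soundness of the call-by-name linear-use CPS translation**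
(Proposition 4.2): if `Θ ⊢ M =_{βη} N : τ` then
`Θⁿᶜ ⊸ R̲ ⊢ Mⁿᶜ = Nⁿᶜ : τⁿᶜ ⊸ R̲` in the equational theory of EEC. -/
theorem cbncps_sound (R : CType) (Θ : List STy) (M N : LTm) (τ : STy)
    (h : LBetaEta Θ M N τ) (dM : LDeriv Θ M τ) (dN : LDeriv Θ N τ) :
    EEq (cbncpsCtx R Θ) none (cbncps R dM) (cbncps R dN)
      (.lin (cbncpsT R τ) R) := by
  obtain ⟨eM, eN, e⟩ := h.exists_cbncps_eq R
  rwa [Subsingleton.elim dM eM, Subsingleton.elim dN eN]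

end EEC
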